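/- Let ξ ∈ ℝ. There exists a constant κ > 0 depending only on ξ such that for all x = (x₀,x₁,x₂,x₃) and y = (y₀,y₁,y₂,y₃) in ℝ⁴: |C(x,y)⁻ − x₀det(Δ²x, Δy⁻) − y₀det(Δx⁻, Δ²x)| ≤ κL(x)²L(y), |C(x,y)⁺ − x₀det(Δ²x, Δy⁺) − y₀ξ·det(Δx⁻, Δ²x)| ≤ κL(x)²L(y), and |ΔC(x,y) − x₀det(Δ²x, Δ²y)| ≤ κL(x)²L(y). -/

import Mathlib

noncomputable section

/-- x⁻ = (x₀,x₁,x₂). -/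
def vm (x : Fin 4 → ℝ) : Fin 3 → ℝ := ![x 0, x 1, x 2]

/-- x⁺ = (x₁,x₂,x₃). -/
def vp (x : Fin 4 → ℝ) : Fin 3 → ℝ := ![x 1, x 2, x 3]

/-- Δ on ℝ⁴ : Δx = x⁺ − ξx⁻ ∈ ℝ³. -/
def D4 (ξ : ℝ) (x : Fin 4 → ℝ) : Fin 3 → ℝ :=
  ![x 1 - ξ * x 0, x 2 - ξ * x 1, x 3 - ξ * x 2]

/-- Δ on ℝ³ : Δv = v⁺ − ξv⁻ ∈ ℝ². -/
def D3 (ξ : ℝ) (v : Fin 3 → ℝ) : Fin 2 → ℝ :=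
  ![v 1 - ξ * v 0, v 2 - ξ * v 1]

/-- Determinant of the 3×3 matrix with rows a, b, c. -/
def det3 (a b c : Fin 3 → ℝ) : ℝ := Matrix.det (Matrix.of ![a, b, c])

/-- Determinant of the 2×2 matrix with rows a, b. -/
def det2 (a b : Fin 2 → ℝ) : ℝ := Matrix.det (Matrix.of ![a, b])

/-- The map C(x,y) = (det(x⁻,x⁺,y⁻), det(x⁻,x⁺,y⁺)). -/
def Cmap (x y : Fin 4 → ℝ) : Fin 2 → ℝ :=
  ![det3 (vm x) (vp x) (vm y), det3 (vm x) (vp x) (vp y)]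

/-- L(x) = max_{1≤i≤3}|x₀ξⁱ − x_i|. -/
def L4 (ξ : ℝ) (x : Fin 4 → ℝ) : ℝ :=
  max (max |x 0 * ξ - x 1| |x 0 * ξ ^ 2 - x 2|) |x 0 * ξ ^ 3 - x 3|

lemma det2_eq (u v : Fin 2 → ℝ) : det2 u v = u 0 * v 1 - u 1 * v 0 := by
  simp [det2, Matrix.det_fin_two]

/-- Expansion of a 3×3 determinant after the column operations that replace each row `v` by
`(v₀, Δv)`. -/
lemma det3_eq_det2_D3 (ξ : ℝ) (a b c : Fin 3 → ℝ) :
    det3 a b c = a 0 * det2 (D3 ξ b) (D3 ξ c) - b 0 * det2 (D3 ξ a) (D3 ξ c)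
      + c 0 * det2 (D3 ξ a) (D3 ξ b) := by
  simp [det3, det2_eq, D3, Matrix.det_fin_three]
  ring

lemma abs_det2_le {u v : Fin 2 → ℝ} {A B : ℝ} (hu : ∀ i, |u i| ≤ A) (hv : ∀ i, |v i| ≤ B) :
    |det2 u v| ≤ 2 * (A * B) := by
  have hA : 0 ≤ A := (abs_nonneg _).trans (hu 0)
  have mul_bound (i j : Fin 2) : |u i * v j| ≤ A * B := by
    rw [abs_mul]
    exact mul_le_mul (hu i) (hv j) (abs_nonneg _) hA
  rw [det2_eq]
  linarith [abs_sub (u 0 * v 1) (u 1 * v 0), mul_bound 0 1, mul_bound 1 0]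

lemma L4_nonneg (ξ : ℝ) (x : Fin 4 → ℝ) : 0 ≤ L4 ξ x :=
  (abs_nonneg _).trans (le_max_right _ _)

lemma abs_sub_mul_le {ξ a b A : ℝ} (ha : |a| ≤ A) (hb : |b| ≤ A) :
    |b - ξ * a| ≤ (1 + |ξ|) * A := by
  have hmul : |ξ * a| ≤ |ξ| * A := by
    rw [abs_mul]
    exact mul_le_mul_of_nonneg_left ha (abs_nonneg ξ)
  linarith [abs_sub b (ξ * a)]

lemma abs_D4_le (ξ : ℝ) (x : Fin 4 → ℝ) (i : Fin 3) :
    |D4 ξ x i| ≤ (1 + |ξ|) * L4 ξ x := by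
  have h₁ : |x 1 - x 0 * ξ| ≤ L4 ξ x := by
    rw [abs_sub_comm]
    exact (le_max_left _ _).trans (le_max_left _ _)
  have h₂ : |x 2 - x 0 * ξ ^ 2| ≤ L4 ξ x := by
    rw [abs_sub_comm]
    exact (le_max_right _ _).trans (le_max_left _ _)
  have h₃ : |x 3 - x 0 * ξ ^ 3| ≤ L4 ξ x := by
    rw [abs_sub_comm]
    exact le_max_right _ _
  have h₀ : |(0 : ℝ)| ≤ L4 ξ x := by simpa using L4_nonneg ξ x
  fin_cases i
  · convert abs_sub_mul_le (ξ := ξ) h₀ h₁ using 2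
    simp [D4]
    ring
  · convert abs_sub_mul_le (ξ := ξ) h₁ h₂ using 2
    simp [D4]
    ring
  · convert abs_sub_mul_le (ξ := ξ) h₂ h₃ using 2
    simp [D4]
    ring

lemma abs_D3_D4_le (ξ : ℝ) (x : Fin 4 → ℝ) (i : Fin 2) :
    |D3 ξ (D4 ξ x) i| ≤ (1 + |ξ|) ^ 2 * L4 ξ x := by
  rw [pow_two, mul_assoc]
  fin_cases i
  · exact abs_sub_mul_le (abs_D4_le ξ x 0) (abs_D4_le ξ x 1)
  · exact abs_sub_mul_le (abs_D4_le ξ x 1) (abs_D4_le ξ x 2)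

lemma abs_D4_le_sq (ξ : ℝ) (x : Fin 4 → ℝ) (i : Fin 3) :
    |D4 ξ x i| ≤ (1 + |ξ|) ^ 2 * L4 ξ x := by
  refine (abs_D4_le ξ x i).trans (mul_le_mul_of_nonneg_right ?_ (L4_nonneg ξ x))
  exact le_self_pow₀ (by linarith [abs_nonneg ξ]) two_ne_zero

lemma abs_D3_vm_le (ξ : ℝ) (x : Fin 4 → ℝ) (i : Fin 2) :
    |D3 ξ (vm x) i| ≤ (1 + |ξ|) ^ 2 * L4 ξ x := by
  fin_cases i
  · exact abs_D4_le_sq ξ x 0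
  · exact abs_D4_le_sq ξ x 1

lemma abs_D3_vp_le (ξ : ℝ) (x : Fin 4 → ℝ) (i : Fin 2) :
    |D3 ξ (vp x) i| ≤ (1 + |ξ|) ^ 2 * L4 ξ x := by
  fin_cases i
  · exact abs_D4_le_sq ξ x 1
  · exact abs_D4_le_sq ξ x 2

/-- Since `x⁺ = Δx + ξx⁻`, the row `x⁺` may be replaced by `Δx`. -/
lemma det3_vm_vp (ξ : ℝ) (x : Fin 4 → ℝ) (c : Fin 3 → ℝ) :
    det3 (vm x) (vp x) c = det3 (vm x) (D4 ξ x) c := by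
  simp [det3, vm, vp, D4, Matrix.det_fin_three]
  ring

lemma Cmap_sub_mul (ξ : ℝ) (x y : Fin 4 → ℝ) :
    Cmap x y 1 - ξ * Cmap x y 0 = det3 (vm x) (vp x) (D4 ξ y) := by
  simp [Cmap, det3, vm, vp, D4, Matrix.det_fin_three]
  ring

theorem statement7 (ξ : ℝ) :
    ∃ κ : ℝ, 0 < κ ∧ ∀ x y : Fin 4 → ℝ,
      |Cmap x y 0 - x 0 * det2 (D3 ξ (D4 ξ x)) (D3 ξ (vm y))
          - y 0 * det2 (D3 ξ (vm x)) (D3 ξ (D4 ξ x))|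
        ≤ κ * L4 ξ x ^ 2 * L4 ξ y ∧
      |Cmap x y 1 - x 0 * det2 (D3 ξ (D4 ξ x)) (D3 ξ (vp y))
          - y 0 * ξ * det2 (D3 ξ (vm x)) (D3 ξ (D4 ξ x))|
        ≤ κ * L4 ξ x ^ 2 * L4 ξ y ∧
      |(Cmap x y 1 - ξ * Cmap x y 0) - x 0 * det2 (D3 ξ (D4 ξ x)) (D3 ξ (D4 ξ y))|
        ≤ κ * L4 ξ x ^ 2 * L4 ξ y := by
  set M : ℝ := (1 + |ξ|) ^ 2
  have hM_pos : 0 < M := by positivity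
  refine ⟨4 * M ^ 3, by positivity, fun x y ↦ ?_⟩
  set X := L4 ξ x
  set Y := L4 ξ y
  have hX : 0 ≤ X := L4_nonneg ξ x
  have hY : 0 ≤ Y := L4_nonneg ξ y
  have first_error (v : Fin 2 → ℝ) (hv : ∀ i, |v i| ≤ M * Y) :
      |D4 ξ x 0 * det2 (D3 ξ (vm x)) v| ≤ 2 * M ^ 3 * X ^ 2 * Y := by
    rw [abs_mul]
    calc _ ≤ (M * X) * (2 * ((M * X) * (M * Y))) :=
          mul_le_mul (abs_D4_le_sq ξ x 0) (abs_det2_le (abs_D3_vm_le ξ x) hv)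
            (abs_nonneg _) (by positivity)
      _ = _ := by ring
  have second_error :
      |D4 ξ y 0 * det2 (D3 ξ (vm x)) (D3 ξ (D4 ξ x))| ≤ 2 * M ^ 3 * X ^ 2 * Y := by
    rw [abs_mul]
    calc _ ≤ (M * Y) * (2 * ((M * X) * (M * X))) :=
          mul_le_mul (abs_D4_le_sq ξ y 0)
            (abs_det2_le (abs_D3_vm_le ξ x) (abs_D3_D4_le ξ x))
            (abs_nonneg _) (by positivity)
      _ = _ := by ring
  have hminus := first_error _ (abs_D3_vm_le ξ y)
  have hplus := first_error _ (abs_D3_vp_le ξ y)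
  have hdelta := first_error _ (abs_D3_D4_le ξ y)
  rw [abs_le] at second_error hminus hplus hdelta
  have eminus : Cmap x y 0 = _ :=
    (det3_vm_vp ξ x (vm y)).trans (det3_eq_det2_D3 ξ _ _ _)
  have eplus : Cmap x y 1 = _ :=
    (det3_vm_vp ξ x (vp y)).trans (det3_eq_det2_D3 ξ _ _ _)
  have hx₀ : vm x 0 = x 0 := rfl
  have hy₀ : vm y 0 = y 0 := rfl
  have hy₁ : vp y 0 = D4 ξ y 0 + y 0 * ξ := by
    simp [vp, D4]
    ring
  rw [Cmap_sub_mul, det3_vm_vp ξ, det3_eq_det2_D3 ξ, eminus, eplus, hx₀, hy₀, hy₁]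
  simp only [abs_le]
  refine ⟨⟨?_, ?_⟩, ⟨?_, ?_⟩, ⟨?_, ?_⟩⟩ <;> linarith
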